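/- arXiv:1202.0030 — 2 statements merged into one kernel-verified Lean document; each statement's English description precedes it below -/
import Mathlib

section
/- Let a, b, c, t be real numbers with 0 < b ≤ a < π/2, −1 ≤ c ≤ 1, 0 < t ≤ 1, and suppose it is not the case that both a = b and c = 1. Then (a − b·c)·sin(a·t)·cos(b·t) + (b − a·c)·cos(a·t)·sin(b·t) > 0. -/
open Real

theorem stmt_6 (a b c t : ℝ) (hb : 0 < b) (hba : b ≤ a) (ha : a < π / 2)
    (hc₁ : -1 ≤ c) (hc₂ : c ≤ 1) (ht₀ : 0 < t) (ht₁ : t ≤ 1)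
    (hne : ¬(a = b ∧ c = 1)) :
    0 < (a - b * c) * Real.sin (a * t) * Real.cos (b * t) +
        (b - a * c) * Real.cos (a * t) * Real.sin (b * t) := by
  have ha0 : 0 < a := lt_of_lt_of_le hb hba
  have hA0 : 0 < a * t := mul_pos ha0 ht₀
  have hB0 : 0 < b * t := mul_pos hb ht₀
  have hA1 : a * t < π / 2 := by nlinarith
  have hBA : b * t ≤ a * t := by nlinarith
  have hpi := Real.pi_pos
  have sA : 0 < Real.sin (a * t) := Real.sin_pos_of_pos_of_lt_pi hA0 (by linarith)
  have sB : 0 < Real.sin (b * t) := Real.sin_pos_of_pos_of_lt_pi hB0 (by linarith)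
  have cA : 0 < Real.cos (a * t) := Real.cos_pos_of_mem_Ioo ⟨by linarith, hA1⟩
  have cB : 0 < Real.cos (b * t) := Real.cos_pos_of_mem_Ioo ⟨by linarith, by linarith⟩
  have key : (a - b * c) * Real.sin (a * t) * Real.cos (b * t) +
      (b - a * c) * Real.cos (a * t) * Real.sin (b * t) =
      (a - b) * Real.sin (a * t - b * t) + (1 - c) *
        (b * (Real.sin (a * t) * Real.cos (b * t)) +
          a * (Real.cos (a * t) * Real.sin (b * t))) := by
    rw [Real.sin_sub]; ring
  have hq : 0 < b * (Real.sin (a * t) * Real.cos (b * t)) +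
      a * (Real.cos (a * t) * Real.sin (b * t)) := by positivity
  have hs : 0 ≤ Real.sin (a * t - b * t) :=
    Real.sin_nonneg_of_nonneg_of_le_pi (by linarith) (by linarith)
  rw [key]
  rcases hc₂.lt_or_eq with hc | hc
  · exact add_pos_of_nonneg_of_pos (mul_nonneg (by linarith) hs) (mul_pos (by linarith) hq)
  · have hlt : b < a := lt_of_le_of_ne hba (fun h => hne ⟨h.symm, hc⟩)
    have hlt' : b * t < a * t := mul_lt_mul_of_pos_right hlt ht₀
    exact add_pos_of_pos_of_nonneg
      (mul_pos (by linarith) (Real.sin_pos_of_pos_of_lt_pi (by linarith) (by linarith)))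
      (mul_nonneg (by linarith) hq.le)
end

section
/- Let E be a real inner product space, V a finite vertex type, G a simple graph on V, and for x : V → E let φ(x) = (1/2) · Σ over unordered edges {i,j} of G of ‖x i − x j‖². Let ε > 0 satisfy ε · maxDegree(G) < 1, and define the consensus update T(x) i = x i + ε • Σ_{j ∈ N(i)} (x j − x i), where N(i) is the neighbor set of i in G. Then φ(T x) ≤ φ(x), with equality if and only if Σ_{j ∈ N(i)} (x j − x i) = 0 for every i ∈ V. -/
theorem sum_aux {V : Type*} [Fintype V] [DecidableEq V]
    (G : SimpleGraph V) [DecidableRel G.Adj] (F : Sym2 V → ℝ) :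
    ∑ i, ∑ j ∈ G.neighborFinset i, F s(i, j) = 2 * ∑ e ∈ G.edgeFinset, F e := by
  have h1 : ∑ i, ∑ j ∈ G.neighborFinset i, F s(i, j) = ∑ d : G.Dart, F d.edge := by
    rw [Finset.sum_sigma']
    refine Finset.sum_bij' (fun p hp => (⟨(p.1, p.2), by simpa using hp⟩ : G.Dart))
      (fun d _ => ⟨d.fst, d.snd⟩) ?_ ?_ ?_ ?_ ?_
    · intros; simp
    · intro d _; simpa using d.adj
    · intros; rfl
    · intros; rfl
    · intros; rfl
  rw [h1, ← Finset.sum_fiberwise_of_maps_to (s := Finset.univ) (t := G.edgeFinset)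
    (g := fun d : G.Dart => d.edge) (by intro d _; simpa using d.edge_mem), Finset.mul_sum]
  refine Finset.sum_congr rfl fun e he => ?_
  rw [Finset.sum_congr rfl (g := fun _ => F e)
    (by intro d hd; rw [(Finset.mem_filter.1 hd).2]), Finset.sum_const,
    G.dart_edge_fiber_card e (by simpa using he)]
  simp

theorem swap_aux {V M : Type*} [Fintype V] [DecidableEq V] [AddCommMonoid M]
    (G : SimpleGraph V) [DecidableRel G.Adj] (f : V → V → M) :
    ∑ i, ∑ j ∈ G.neighborFinset i, f i j = ∑ i, ∑ j ∈ G.neighborFinset i, f j i := by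
  apply Finset.sum_comm'
  intro a b
  simp [G.adj_comm]

theorem stmt_9 {E : Type*} [NormedAddCommGroup E] [InnerProductSpace ℝ E]
    {V : Type*} [Fintype V] [DecidableEq V]
    (G : SimpleGraph V) [DecidableRel G.Adj]
    (φ : (V → E) → ℝ)
    (hφ : ∀ x : V → E, φ x = (1 / 2) * ∑ e ∈ G.edgeFinset,
      Sym2.lift ⟨fun i j => ‖x i - x j‖ ^ 2, fun i j => by simp [norm_sub_rev]⟩ e)
    (ε : ℝ) (hε : 0 < ε) (hεdeg : ε * (G.maxDegree : ℝ) < 1)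
    (T : (V → E) → (V → E))
    (hT : ∀ (x : V → E) (i : V),
      T x i = x i + ε • ∑ j ∈ G.neighborFinset i, (x j - x i))
    (x : V → E) :
    φ (T x) ≤ φ x ∧
      (φ (T x) = φ x ↔ ∀ i : V, ∑ j ∈ G.neighborFinset i, (x j - x i) = 0) := by
  have hQ : ∀ y : V → E, φ y = (1 / 4) * ∑ i, ∑ j ∈ G.neighborFinset i, ‖y i - y j‖ ^ 2 := by
    intro y
    have := sum_aux G
      (Sym2.lift ⟨fun i j => ‖y i - y j‖ ^ 2, fun i j => by simp [norm_sub_rev]⟩)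
    simp only [Sym2.lift_mk] at this
    rw [hφ, this]; ring
  obtain ⟨g, hg⟩ : ∃ g : V → E, ∀ i, g i = ∑ j ∈ G.neighborFinset i, (x j - x i) :=
    ⟨_, fun _ => rfl⟩
  simp only [← hg]
  have hB : ∑ i, ∑ j ∈ G.neighborFinset i, inner ℝ (x i - x j) (g i - g j)
      = -2 * ∑ i, ‖g i‖ ^ 2 := by
    have h1 : ∑ i, ∑ j ∈ G.neighborFinset i, inner ℝ (x i - x j) (g i)
        = - ∑ i, ‖g i‖ ^ 2 := by
      rw [← Finset.sum_neg_distrib]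
      refine Finset.sum_congr rfl fun i _ => ?_
      rw [← sum_inner, ← real_inner_self_eq_norm_sq, ← inner_neg_left]
      congr 1
      rw [hg, ← Finset.sum_neg_distrib]
      simp
    have h2 := swap_aux G (fun i j => inner ℝ (x i - x j) (g i))
    have h3 : ∑ i, ∑ j ∈ G.neighborFinset i, inner ℝ (x i - x j) (g i - g j)
        = ∑ i, ∑ j ∈ G.neighborFinset i, inner ℝ (x i - x j) (g i)
        + ∑ i, ∑ j ∈ G.neighborFinset i, inner ℝ (x j - x i) (g j) := by
      simp only [← Finset.sum_add_distrib]
      refine Finset.sum_congr rfl fun i _ => Finset.sum_congr rfl fun j _ => ?_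
      rw [inner_sub_right, ← neg_sub (x i) (x j), inner_neg_left]; ring
    rw [h3, ← h2, h1]; ring
  have hD : ∑ i, ∑ j ∈ G.neighborFinset i, ‖g i - g j‖ ^ 2
      ≤ 4 * G.maxDegree * ∑ i, ‖g i‖ ^ 2 := by
    have h1 : ∑ i, ∑ j ∈ G.neighborFinset i, ‖g i‖ ^ 2 ≤ G.maxDegree * ∑ i, ‖g i‖ ^ 2 := by
      rw [Finset.mul_sum]
      refine Finset.sum_le_sum fun i _ => ?_
      rw [Finset.sum_const, nsmul_eq_mul, G.card_neighborFinset_eq_degree]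
      gcongr
      exact G.degree_le_maxDegree i
    have h2 := swap_aux G (fun i _ => ‖g i‖ ^ 2)
    have h3 : ∑ i, ∑ j ∈ G.neighborFinset i, ‖g i - g j‖ ^ 2
        ≤ 2 * (∑ i, ∑ j ∈ G.neighborFinset i, ‖g i‖ ^ 2
          + ∑ i, ∑ j ∈ G.neighborFinset i, ‖g j‖ ^ 2) := by
      simp only [← Finset.sum_add_distrib, Finset.mul_sum]
      refine Finset.sum_le_sum fun i _ => Finset.sum_le_sum fun j _ => ?_
      have := parallelogram_law_with_norm ℝ (g i) (g j)
      nlinarith [sq_nonneg ‖g i + g j‖]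
    linarith
  have hE : φ (T x) = φ x - ε * ∑ i, ‖g i‖ ^ 2
      + ε ^ 2 / 4 * ∑ i, ∑ j ∈ G.neighborFinset i, ‖g i - g j‖ ^ 2 := by
    have h : ∑ i, ∑ j ∈ G.neighborFinset i, ‖T x i - T x j‖ ^ 2
        = ∑ i, ∑ j ∈ G.neighborFinset i, ‖x i - x j‖ ^ 2
        + 2 * ε * ∑ i, ∑ j ∈ G.neighborFinset i, inner ℝ (x i - x j) (g i - g j)
        + ε ^ 2 * ∑ i, ∑ j ∈ G.neighborFinset i, ‖g i - g j‖ ^ 2 := by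
      simp only [Finset.mul_sum, ← Finset.sum_add_distrib]
      refine Finset.sum_congr rfl fun i _ => Finset.sum_congr rfl fun j _ => ?_
      have e : T x i - T x j = (x i - x j) + ε • (g i - g j) := by
        rw [hT, hT, ← hg, ← hg, smul_sub]; abel
      rw [e, norm_add_sq_real, inner_smul_right, norm_smul, mul_pow, Real.norm_eq_abs, sq_abs]
      ring
    rw [hQ, hQ, h, hB]; ring
  have hS : 0 ≤ ∑ i, ‖g i‖ ^ 2 := Finset.sum_nonneg fun i _ => sq_nonneg _
  have key : φ (T x) ≤ φ x - ε * (1 - ε * G.maxDegree) * ∑ i, ‖g i‖ ^ 2 := by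
    have := mul_le_mul_of_nonneg_left hD (by positivity : 0 ≤ ε ^ 2 / 4)
    rw [hE]; linarith
  have hc : 0 < ε * (1 - ε * G.maxDegree) := mul_pos hε (by linarith)
  refine ⟨by nlinarith [mul_nonneg hc.le hS], fun h => ?_, fun h => ?_⟩
  · have h0 : ∑ i, ‖g i‖ ^ 2 = 0 := by
      by_contra hne
      have := mul_pos hc (lt_of_le_of_ne hS (Ne.symm hne))
      linarith
    intro i
    have := (Finset.sum_eq_zero_iff_of_nonneg fun i _ => sq_nonneg ‖g i‖).1 h0 i
      (Finset.mem_univ i)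
    simpa using this
  · rw [hE]; simp [h]
end
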